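/- arXiv:1511.07969 — 4 statements merged into one kernel-verified Lean document; each statement's English description precedes it below -/
import Mathlib

section
/- Let p > 2 be prime. Let ξ and η be independent identically distributed random variables with values in ℚ_p whose common distribution μ has a continuous density ρ with respect to the Haar measure m on ℚ_p. Then the random variables S = ξ + η and D = (ξ − η)² are independent if and only if μ is an idempotent distribution, i.e. there exist an integer n and an element x₀ ∈ ℚ_p such that μ is the translate by x₀ of the normalized Haar distribution of the compact subgroup p^n ℤ_p. -/
open MeasureTheory ProbabilityTheory

section AuxAll
open Filter Topology

section
variable {p : ℕ} [Fact p.Prime]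

theorem aux_norm_two (hp : 2 < p) : ‖(2 : ℚ_[p])‖ = 1 := by
  have h := (Padic.norm_natCast_eq_one_iff (p := p) (n := 2)).2
    ((Nat.coprime_primes (Fact.out) Nat.prime_two).2 (by omega))
  simpa using h

variable [MeasurableSpace ℚ_[p]] [BorelSpace ℚ_[p]]

theorem aux_mp (hp : 2 < p) (m : Measure ℚ_[p]) [m.IsAddHaarMeasure]
    (hm : m {x : ℚ_[p] | ‖x‖ ≤ 1} = 1) (s : ℚ_[p]) :
    MeasurePreserving (fun y : ℚ_[p] => s + (-2) * y) m m := by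
  have h2 : (-2 : ℚ_[p]) ≠ 0 := by norm_num
  have hc : Measurable (fun y : ℚ_[p] => (-2) * y) := (continuous_const_mul _).measurable
  have hH : (Measure.map (fun y : ℚ_[p] => (-2) * y) m).IsAddHaarMeasure :=
    ({ Equiv.mulLeft₀ (-2 : ℚ_[p]) h2 with map_add' := mul_add _ } : ℚ_[p] ≃+ ℚ_[p]).isAddHaarMeasure_map m
      (Homeomorph.mulLeft₀ (-2 : ℚ_[p]) h2).continuous (Homeomorph.mulLeft₀ (-2 : ℚ_[p]) h2).symm.continuous
  have hmS : MeasurableSet {x : ℚ_[p] | ‖x‖ ≤ 1} :=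
    (isClosed_le continuous_norm continuous_const).measurableSet
  have h1 : MeasurePreserving (fun y : ℚ_[p] => (-2) * y) m m := by
    refine ⟨hc, ?_⟩
    have e := Measure.isAddLeftInvariant_eq_smul (Measure.map (fun y : ℚ_[p] => (-2) * y) m) m
    have e1 := congrArg (fun ν : Measure ℚ_[p] => ν {x : ℚ_[p] | ‖x‖ ≤ 1}) e
    rw [Measure.map_apply hc hmS] at e1
    have : (fun y : ℚ_[p] => (-2) * y) ⁻¹' {x : ℚ_[p] | ‖x‖ ≤ 1} = {x : ℚ_[p] | ‖x‖ ≤ 1} := by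
      ext y
      simp [aux_norm_two hp]
    rw [this, Measure.smul_apply, hm] at e1
    have e2 : Measure.addHaarScalarFactor (Measure.map (fun y : ℚ_[p] => (-2) * y) m) m = 1 := by
      simpa [ENNReal.smul_def] using e1.symm
    rw [e, e2, one_smul]
  exact (measurePreserving_add_left m s).comp h1

theorem aux_mp2 (hp : 2 < p) (m : Measure ℚ_[p]) [m.IsAddHaarMeasure]
    (hm : m {x : ℚ_[p] | ‖x‖ ≤ 1} = 1) :
    MeasurePreserving (fun z : ℚ_[p] × ℚ_[p] => (z.1 + z.2, z.1 - z.2)) (m.prod m) (m.prod m) := by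
  have h1 := measurePreserving_add_prod (G := ℚ_[p]) m m
  have h2 : MeasurePreserving (fun z : ℚ_[p] × ℚ_[p] => (z.1, z.1 + (-2) * z.2))
      (m.prod m) (m.prod m) :=
    (MeasurePreserving.id m).skew_product (g := fun s y : ℚ_[p] => s + (-2) * y)
      (by simp only [Function.uncurry_def]; fun_prop)
      (ae_of_all _ fun s => (aux_mp hp m hm s).map_eq)
  convert h2.comp h1 using 1
  ext z <;> simp
  ring

theorem aux_law (hp : 2 < p) (m : Measure ℚ_[p]) [m.IsAddHaarMeasure]
    (hm : m {x : ℚ_[p] | ‖x‖ ≤ 1} = 1)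
    {Ω : Type*} [MeasurableSpace Ω] (P : Measure Ω) [IsProbabilityMeasure P]
    (ξ η : Ω → ℚ_[p]) (hξ : Measurable ξ) (hη : Measurable η)
    (hindep : IndepFun ξ η P) (f : ℚ_[p] → ENNReal) (hf : Measurable f)
    (hξd : Measure.map ξ P = m.withDensity f)
    (hηd : Measure.map η P = m.withDensity f) :
    Measure.map (fun ω => (ξ ω + η ω, ξ ω - η ω)) P =
      (m.prod m).withDensity fun z => f ((z.1 + z.2) / 2) * f ((z.1 - z.2) / 2) := by
  have h := (indepFun_iff_map_prod_eq_prod_map_map hξ.aemeasurable hη.aemeasurable).1 hindep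
  rw [hξd, hηd, prod_withDensity hf hf] at h
  have hT : Measurable (fun z : ℚ_[p] × ℚ_[p] => (z.1 + z.2, z.1 - z.2)) := by fun_prop
  have : Measure.map (fun ω => (ξ ω + η ω, ξ ω - η ω)) P =
    Measure.map (fun z : ℚ_[p] × ℚ_[p] => (z.1 + z.2, z.1 - z.2))
      (Measure.map (fun ω => (ξ ω, η ω)) P) := by
    rw [Measure.map_map hT (hξ.prodMk hη)]; rfl
  rw [this, h]
  ext A hA
  have h2 : (2 : ℚ_[p]) ≠ 0 := by norm_num
  rw [Measure.map_apply hT hA, withDensity_apply _ (hT hA), withDensity_apply _ hA]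
  rw [← (aux_mp2 hp m hm).setLIntegral_comp_preimage hA (by fun_prop)]
  congr 1
  ext z
  have e1 : (z.1 + z.2 + (z.1 - z.2)) / 2 = z.1 := by field_simp; ring
  have e2 : (z.1 + z.2 - (z.1 - z.2)) / 2 = z.2 := by field_simp; ring
  simp only [e1, e2]

end

section
variable {p : ℕ} [Fact p.Prime]

theorem aux_pow_le {x C : ℝ} (h : ∀ k : ℕ, x ^ (2 ^ k) ≤ C) : x ≤ 1 := by
  by_contra hx
  push Not at hx
  obtain ⟨n, hn⟩ := pow_unbounded_of_one_lt C hx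
  have := (pow_le_pow_right₀ hx.le (Nat.lt_two_pow_self (n := n)).le).trans (h n)
  linarith

theorem aux_pow_eq {x c C : ℝ} (hx : 0 < x) (hc : 0 < c)
    (h : ∀ k : ℕ, c ≤ x ^ (2 ^ k) ∧ x ^ (2 ^ k) ≤ C) : x = 1 := by
  apply le_antisymm (aux_pow_le fun k => (h k).2)
  have : x⁻¹ ≤ 1 := by
    apply aux_pow_le (C := c⁻¹)
    intro k
    rw [inv_pow]
    exact inv_anti₀ hc (h k).1
  exact (inv_le_one₀ hx).1 this

/-- the functional equation, normalised -/
theorem aux_func (hp : ‖(2 : ℚ_[p])‖ = 1) (r : ℚ_[p] → ℝ) (hc : Continuous r) (hnn : ∀ x, 0 ≤ r x)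
    (h0 : r 0 = 1) (hfe : ∀ a b, r (a + b) * r (a - b) = r a ^ 2 * (r b * r (-b))) :
    ∃ E : AddSubgroup ℚ_[p], IsOpen (E : Set ℚ_[p]) ∧ (∀ x ∈ E, r x = 1) ∧ ∀ x ∉ E, r x = 0 := by
  have h2 : (2 : ℚ_[p]) ≠ 0 := by norm_num
  have hd : ∀ a, r (2 * a) = r a ^ 2 * (r a * r (-a)) := by
    intro a
    have := hfe a a
    rw [sub_self, h0, mul_one, ← two_mul] at this
    exact this
  have hpos : ∀ x, r x ≠ 0 → 0 < r x := fun x hx => lt_of_le_of_ne (hnn x) (Ne.symm hx)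
  have hneg : ∀ x, r x ≠ 0 → r (-x) ≠ 0 := by
    intro x hx
    have e1 := hd (x / 2)
    have e2 := hd (-(x / 2))
    have t1 : 2 * (x / 2) = x := by field_simp
    have t2 : 2 * -(x / 2) = -x := by field_simp
    rw [t1] at e1
    rw [t2, neg_neg] at e2
    rw [e1] at hx
    rw [e2]
    have u1 : r (x / 2) ≠ 0 := by rintro h; simp [h] at hx
    have u2 : r (-(x / 2)) ≠ 0 := by rintro h; simp [h] at hx
    positivity
  have hadd : ∀ x y, r x ≠ 0 → r y ≠ 0 → r (x + y) ≠ 0 := by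
    intro x y hx hy h
    have := hfe x y
    rw [h, zero_mul] at this
    have := hneg y hy
    have : r x ^ 2 * (r y * r (-y)) ≠ 0 := by positivity
    exact this (by linarith)
  let E : AddSubgroup ℚ_[p] :=
    { carrier := {x | r x ≠ 0}
      add_mem' := fun {x y} hx hy => hadd x y hx hy
      zero_mem' := by simp [h0]
      neg_mem' := fun {x} hx => hneg x hx }
  have hEm : ∀ x, x ∈ E ↔ r x ≠ 0 := fun x => Iff.rfl
  have hEo : IsOpen (E : Set ℚ_[p]) := isOpen_ne_fun hc continuous_const
  have hEc : IsClosed (E : Set ℚ_[p]) := AddSubgroup.isClosed_of_isOpen E hEo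
  have key : ∀ a ∈ E, ∃ c C : ℝ, 0 < c ∧ ∀ k : ℕ, c ≤ r (2 ^ k * a) ∧ r (2 ^ k * a) ≤ C := by
    intro a ha
    have hK : IsCompact ((E : Set ℚ_[p]) ∩ Metric.closedBall 0 ‖a‖) :=
      (isCompact_closedBall _ _).inter_left hEc
    have hne : ((E : Set ℚ_[p]) ∩ Metric.closedBall 0 ‖a‖).Nonempty := ⟨a, ha, by simp⟩
    obtain ⟨u, hu, hu'⟩ := hK.exists_isMinOn hne hc.continuousOn
    obtain ⟨v, hv, hv'⟩ := hK.exists_isMaxOn hne hc.continuousOn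
    refine ⟨r u, r v, hpos _ hu.1, fun k => ?_⟩
    have hmem : 2 ^ k * a ∈ (E : Set ℚ_[p]) ∩ Metric.closedBall 0 ‖a‖ := by
      constructor
      · have := E.nsmul_mem ha (2 ^ k)
        simpa using this
      · simp [hp]
    exact ⟨hu' hmem, hv' hmem⟩
  have hg : ∀ a ∈ E, r a * r (-a) = 1 := by
    intro a ha
    have hit : ∀ k : ℕ, r (2 ^ k * a) * r (2 ^ k * (-a)) = ((r a * r (-a)) ^ (2 ^ k)) ^ (2 ^ k) := by
      intro k
      induction k with
      | zero => simp
      | succ k ih =>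
        have e1 := hd (2 ^ k * a)
        have e2 := hd (2 ^ k * (-a))
        rw [← mul_assoc, ← pow_succ'] at e1 e2
        rw [e1, e2]
        have n1 : -(2 ^ k * a) = 2 ^ k * (-a) := by ring
        have n2 : -(2 ^ k * (-a)) = 2 ^ k * a := by ring
        rw [n1, n2]
        calc _ = (r (2 ^ k * a) * r (2 ^ k * (-a))) ^ 4 := by ring
          _ = _ := by rw [ih]; ring
    obtain ⟨c, C, hc0, hcC⟩ := key a ha
    obtain ⟨c', C', hc0', hcC'⟩ := key (-a) (E.neg_mem ha)
    have hga : 0 < r a * r (-a) := mul_pos (hpos _ ha) (hpos _ (hneg _ ha))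
    -- use bound with exponent 4^k
    have hb : ∀ k : ℕ, c * c' ≤ ((r a * r (-a)) ^ (2 ^ k)) ^ (2 ^ k) ∧
        ((r a * r (-a)) ^ (2 ^ k)) ^ (2 ^ k) ≤ C * C' := by
      intro k
      rw [← hit k]
      refine ⟨mul_le_mul (hcC k).1 (hcC' k).1 hc0'.le (hnn _),
        mul_le_mul (hcC k).2 (hcC' k).2 (hnn _) ((hnn _).trans (hcC k).2)⟩
    have hCC : 0 < C * C' := mul_pos (hc0.trans_le ((hcC 0).1.trans (hcC 0).2))
      (hc0'.trans_le ((hcC' 0).1.trans (hcC' 0).2))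
    refine aux_pow_eq (c := min (c * c') 1) (C := max (C * C') 1) hga (by positivity) fun k => ?_
    have hy : 0 ≤ (r a * r (-a)) ^ (2 ^ k) := by positivity
    have hk1 : 2 ^ k ≠ 0 := by positivity
    rcases le_total ((r a * r (-a)) ^ (2 ^ k)) 1 with h1 | h1
    · have := pow_le_of_le_one hy h1 hk1
      exact ⟨(min_le_left _ _).trans ((hb k).1.trans this), h1.trans (le_max_right _ _)⟩
    · have := le_self_pow₀ h1 hk1
      exact ⟨(min_le_right _ _).trans h1, (this.trans (hb k).2).trans (le_max_left _ _)⟩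
  refine ⟨E, hEo, ?_, fun x hx => by simpa [hEm] using hx⟩
  intro a ha
  have hit : ∀ k : ℕ, r (2 ^ k * a) = r a ^ (2 ^ k) := by
    intro k
    induction k with
    | zero => simp
    | succ k ih =>
      have e1 := hd (2 ^ k * a)
      have hm : 2 ^ k * a ∈ E := by
        have := E.nsmul_mem ha (2 ^ k)
        simpa using this
      rw [← mul_assoc, ← pow_succ', hg _ hm, ih] at e1
      rw [e1]; ring
  obtain ⟨c, C, hc0, hcC⟩ := key a ha
  exact aux_pow_eq (hpos _ ha) hc0 fun k => by rw [← hit k]; exact hcC k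

theorem aux_ball_sub (E : AddSubgroup ℚ_[p]) (hEo : IsOpen (E : Set ℚ_[p])) {x y : ℚ_[p]}
    (hx : x ∈ E) (hyx : ‖y‖ ≤ ‖x‖) : y ∈ E := by
  have hEc : IsClosed (E : Set ℚ_[p]) := AddSubgroup.isClosed_of_isOpen E hEo
  rcases eq_or_ne x 0 with rfl | hx0
  · have : y = 0 := by simpa using hyx
    rw [this]; exact E.zero_mem
  have hz : ‖y / x‖ ≤ 1 := by
    rw [norm_div]; exact div_le_one_of_le₀ hyx (norm_nonneg _)
  have hcl : IsClosed {z : ℤ_[p] | (z : ℚ_[p]) * x ∈ E} :=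
    hEc.preimage (by fun_prop : Continuous fun z : ℤ_[p] => (z : ℚ_[p]) * x)
  have hden := PadicInt.denseRange_natCast (p := p)
  have hall := hden.induction_on (p := fun z : ℤ_[p] => (z : ℚ_[p]) * x ∈ E) ⟨y / x, hz⟩ hcl
    (fun n => by simpa using E.nsmul_mem hx n)
  simpa [hx0] using hall

theorem aux_subgroup (E : AddSubgroup ℚ_[p]) (hEo : IsOpen (E : Set ℚ_[p])) 
    (hne : (E : Set ℚ_[p]) ≠ Set.univ) :
    ∃ n : ℤ, (E : Set ℚ_[p]) = {x | ‖x‖ ≤ (p : ℝ) ^ (-n)} := by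
  have hEc : IsClosed (E : Set ℚ_[p]) := AddSubgroup.isClosed_of_isOpen E hEo
  obtain ⟨w, hw⟩ : ∃ w, w ∉ E := by
    by_contra h
    push Not at h
    exact hne (Set.eq_univ_of_forall h)
  have hb : ∀ x ∈ E, ‖x‖ ≤ ‖w‖ := by
    intro x hx
    by_contra h
    push Not at h
    exact hw (aux_ball_sub E hEo hx h.le)
  have hK : IsCompact (E : Set ℚ_[p]) :=
    (isCompact_closedBall 0 ‖w‖).of_isClosed_subset hEc (fun x hx => by simpa using hb x hx)
  obtain ⟨x, hx, hmax⟩ := hK.exists_isMaxOn ⟨0, E.zero_mem⟩ continuous_norm.continuousOn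
  have hx0 : x ≠ 0 := by
    rintro rfl
    obtain ⟨ε, hε, hεE⟩ := Metric.isOpen_iff.1 hEo 0 E.zero_mem
    obtain ⟨z, hz0, hz⟩ := NormedField.exists_norm_lt ℚ_[p] hε
    have : ‖z‖ ≤ ‖(0 : ℚ_[p])‖ := hmax (hεE (by simpa using hz))
    simp at this
    simp [this] at hz0
  obtain ⟨n, hn⟩ : ∃ n : ℤ, ‖x‖ = (p : ℝ) ^ (-n) := ⟨_, Padic.norm_eq_zpow_neg_valuation hx0⟩
  refine ⟨n, ?_⟩
  ext y
  rw [Set.mem_ofPred_eq]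
  have hn' : (p : ℝ) ^ (-n) = ‖x‖ := hn.symm
  rw [hn']
  exact ⟨fun hy => hmax hy, fun hy => aux_ball_sub E hEo hx hy⟩
end

section
variable {p : ℕ} [Fact p.Prime] [MeasurableSpace ℚ_[p]] [BorelSpace ℚ_[p]]

theorem aux_avg {α : Type*} [MeasurableSpace α] (ν : Measure α) (F : α → ℝ) (C : Set α)
    (hC : MeasurableSet C) (h0 : ν C ≠ 0) (h1 : ν C ≠ ⊤) (L ε : ℝ) (hL : 0 ≤ L) (hε : 0 ≤ ε)
    (h : ∀ x ∈ C, |F x - L| ≤ ε) :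
    |(ν.withDensity (fun x => ENNReal.ofReal (F x)) C).toReal / (ν C).toReal - L| ≤ ε := by
  rw [withDensity_apply _ hC]
  have hup : ∫⁻ x in C, ENNReal.ofReal (F x) ∂ν ≤ ENNReal.ofReal (L + ε) * ν C := by
    rw [← setLIntegral_const]
    refine setLIntegral_mono' hC fun x hx => ENNReal.ofReal_le_ofReal ?_
    have := abs_le.1 (h x hx); linarith
  have hlo : ENNReal.ofReal (L - ε) * ν C ≤ ∫⁻ x in C, ENNReal.ofReal (F x) ∂ν := by
    rw [← setLIntegral_const]
    refine setLIntegral_mono' hC fun x hx => ENNReal.ofReal_le_ofReal ?_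
    have := abs_le.1 (h x hx); linarith
  have hfin : ENNReal.ofReal (L + ε) * ν C ≠ ⊤ := ENNReal.mul_ne_top ENNReal.ofReal_ne_top h1
  have hup' := ENNReal.toReal_mono hfin hup
  have hlo' := ENNReal.toReal_mono (ne_top_of_le_ne_top hfin hup) hlo
  rw [ENNReal.toReal_mul] at hup' hlo'
  rw [ENNReal.toReal_ofReal (by linarith)] at hup'
  have hpos : 0 < (ν C).toReal := ENNReal.toReal_pos h0 h1
  have hl2 : L - ε ≤ (ENNReal.ofReal (L - ε)).toReal := by
    rw [ENNReal.toReal_ofReal']; exact le_max_left _ _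
  rw [abs_le]
  constructor
  · have : L - ε ≤ (∫⁻ x in C, ENNReal.ofReal (F x) ∂ν).toReal / (ν C).toReal := by
      rw [le_div_iff₀ hpos]
      exact (mul_le_mul_of_nonneg_right hl2 hpos.le).trans hlo'
    linarith
  · have : (∫⁻ x in C, ENNReal.ofReal (F x) ∂ν).toReal / (ν C).toReal ≤ L + ε := by
      rw [div_le_iff₀ hpos]
      exact hup'
    linarith

theorem aux_lim (m : Measure ℚ_[p]) [m.IsAddHaarMeasure]
    (F : ℚ_[p] × ℚ_[p] → ℝ) (hF : Continuous F) (hnn : ∀ z, 0 ≤ F z)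
    (hev : ∀ s t, F (s, -t) = F (s, t)) (s t : ℚ_[p]) :
    Tendsto (fun r : ℝ => ((m.prod m).withDensity (fun z => ENNReal.ofReal (F z))
        (Metric.ball s r ×ˢ ((fun x : ℚ_[p] => x ^ 2) ⁻¹' Metric.ball (t ^ 2) r))).toReal /
      ((m (Metric.ball s r)).toReal *
        (m ((fun x : ℚ_[p] => x ^ 2) ⁻¹' Metric.ball (t ^ 2) r)).toReal))
      (𝓝[>] 0) (𝓝 (F (s, t))) := by
  rw [Metric.tendsto_nhds]
  intro ε hε
  obtain ⟨δ, hδ, hδF⟩ := Metric.continuous_iff.1 hF (s, t) (ε / 2) (half_pos hε)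
  have hlt : 0 < min δ (δ ^ 2) := by positivity
  filter_upwards [Ioo_mem_nhdsGT hlt] with r hr
  have hr1 : r < δ := hr.2.trans_le (min_le_left _ _)
  have hr2 : r < δ ^ 2 := hr.2.trans_le (min_le_right _ _)
  have hA : IsOpen (Metric.ball s r) := Metric.isOpen_ball
  have hB : IsOpen ((fun x : ℚ_[p] => x ^ 2) ⁻¹' Metric.ball (t ^ 2) r) :=
    Metric.isOpen_ball.preimage (by fun_prop)
  have hBt : ∀ x ∈ (fun x : ℚ_[p] => x ^ 2) ⁻¹' Metric.ball (t ^ 2) r,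
      dist x t < δ ∨ dist (-x) t < δ := by
    intro x hx
    rw [Set.mem_preimage, Metric.mem_ball, dist_eq_norm] at hx
    by_contra! hcon
    rw [dist_eq_norm, dist_eq_norm] at hcon
    have e : ‖x ^ 2 - t ^ 2‖ = ‖x - t‖ * ‖-x - t‖ := by
      rw [← norm_mul, ← norm_neg]; congr 1; ring
    have := mul_le_mul hcon.1 hcon.2 hδ.le (norm_nonneg _)
    rw [← e] at this
    nlinarith
  have hA0 : m (Metric.ball s r) ≠ 0 := (Metric.measure_ball_pos m s hr.1).ne'
  have hA1 : m (Metric.ball s r) ≠ ⊤ := measure_ball_lt_top.ne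
  have hB0 : m ((fun x : ℚ_[p] => x ^ 2) ⁻¹' Metric.ball (t ^ 2) r) ≠ 0 :=
    (hB.measure_pos m ⟨t, by simpa using hr.1⟩).ne'
  have hB1 : m ((fun x : ℚ_[p] => x ^ 2) ⁻¹' Metric.ball (t ^ 2) r) ≠ ⊤ := by
    refine ((measure_mono (t := Metric.ball t δ ∪ Metric.ball (-t) δ) ?_).trans_lt
      ((measure_union_le _ _).trans_lt
        (ENNReal.add_lt_top.2 ⟨measure_ball_lt_top, measure_ball_lt_top⟩))).ne
    intro x hx
    rcases hBt x hx with h | h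
    · exact Or.inl h
    · refine Or.inr ?_
      rw [Metric.mem_ball, ← dist_neg_neg, neg_neg]; exact h
  rw [← ENNReal.toReal_mul, ← Measure.prod_prod, Real.dist_eq]
  refine (aux_avg (m.prod m) F _ (hA.measurableSet.prod hB.measurableSet) ?_ ?_ _ (ε / 2)
    (hnn _) (by positivity) ?_).trans_lt (by linarith)
  · rw [Measure.prod_prod]; exact mul_ne_zero hA0 hB0
  · rw [Measure.prod_prod]; exact ENNReal.mul_ne_top hA1 hB1
  · rintro ⟨a, b⟩ ⟨ha, hb⟩
    simp only at ha hb
    have ha' : dist a s < δ := lt_trans ha hr1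
    rcases hBt b hb with h | h
    · exact (hδF (a, b) (by rw [Prod.dist_eq]; exact max_lt ha' h)).le
    · rw [← hev a b]
      exact (hδF (a, -b) (by rw [Prod.dist_eq]; exact max_lt ha' h)).le

theorem aux_fe (hp : 2 < p) (m : Measure ℚ_[p]) [m.IsAddHaarMeasure]
    (hm : m {x : ℚ_[p] | ‖x‖ ≤ 1} = 1)
    {Ω : Type*} [MeasurableSpace Ω] (P : Measure Ω) [IsProbabilityMeasure P]
    (ξ η : Ω → ℚ_[p]) (hξ : Measurable ξ) (hη : Measurable η)
    (hindep : IndepFun ξ η P)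
    (ρ : ℚ_[p] → ℝ) (hρc : Continuous ρ) (hρnn : ∀ x, 0 ≤ ρ x)
    (hξd : Measure.map ξ P = m.withDensity fun x => ENNReal.ofReal (ρ x))
    (hηd : Measure.map η P = m.withDensity fun x => ENNReal.ofReal (ρ x))
    (hI : IndepFun (fun ω => ξ ω + η ω) (fun ω => (ξ ω - η ω) ^ 2) P) (a b a' b' : ℚ_[p]) :
    ρ (a + b) * ρ (a - b) * (ρ (a' + b') * ρ (a' - b')) =
      ρ (a + b') * ρ (a - b') * (ρ (a' + b) * ρ (a' - b)) := by
  have hlaw := aux_law hp m hm P ξ η hξ hη hindep (fun x => ENNReal.ofReal (ρ x))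
    (by fun_prop) hξd hηd
  set F : ℚ_[p] × ℚ_[p] → ℝ := fun z => ρ ((z.1 + z.2) / 2) * ρ ((z.1 - z.2) / 2) with hFdef
  have hF : Continuous F := by fun_prop
  have hFnn : ∀ z, 0 ≤ F z := fun z => mul_nonneg (hρnn _) (hρnn _)
  have hev : ∀ s t, F (s, -t) = F (s, t) := by
    intro s t
    simp only [hFdef, sub_neg_eq_add, ← sub_eq_add_neg]
    ring
  simp_rw [← ENNReal.ofReal_mul (hρnn _)] at hlaw
  have hlaw' : Measure.map (fun ω => (ξ ω + η ω, ξ ω - η ω)) P =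
    (m.prod m).withDensity (fun z => ENNReal.ofReal (F z)) := hlaw
  have hlim := aux_lim m F hF hFnn hev
  rw [← hlaw'] at hlim
  have hST : Measurable (fun ω => (ξ ω + η ω, ξ ω - η ω)) := by fun_prop
  have hval : ∀ (s t : ℚ_[p]) (r : ℝ), Measure.map (fun ω => (ξ ω + η ω, ξ ω - η ω)) P
        (Metric.ball s r ×ˢ ((fun x : ℚ_[p] => x ^ 2) ⁻¹' Metric.ball (t ^ 2) r)) =
      P ((fun ω => ξ ω + η ω) ⁻¹' Metric.ball s r) *
        P ((fun ω => (ξ ω - η ω) ^ 2) ⁻¹' Metric.ball (t ^ 2) r) := by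
    intro s t r
    have hB : IsOpen ((fun x : ℚ_[p] => x ^ 2) ⁻¹' Metric.ball (t ^ 2) r) :=
      Metric.isOpen_ball.preimage (by fun_prop)
    rw [Measure.map_apply hST (Metric.isOpen_ball.measurableSet.prod hB.measurableSet)]
    exact hI.measure_inter_preimage_eq_mul _ _ Metric.isOpen_ball.measurableSet
      Metric.isOpen_ball.measurableSet
  simp_rw [hval, ENNReal.toReal_mul] at hlim
  have key : ∀ s t s' t', F (s, t) * F (s', t') = F (s, t') * F (s', t) := by
    intro s t s' t'
    refine tendsto_nhds_unique ((hlim s t).mul (hlim s' t')) ?_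
    refine ((hlim s t').mul (hlim s' t)).congr fun r => ?_
    simp only [div_eq_mul_inv, mul_inv]
    ring
  have h2 : (2 : ℚ_[p]) ≠ 0 := by norm_num
  have e : ∀ a b, F (2 * a, 2 * b) = ρ (a + b) * ρ (a - b) := by
    intro a b
    have e1 : (2 * a + 2 * b) / 2 = a + b := by field_simp
    have e2 : (2 * a - 2 * b) / 2 = a - b := by field_simp
    simp only [hFdef, e1, e2]
  have := key (2 * a) (2 * b) (2 * a') (2 * b')
  simpa only [e] using this

theorem aux_shift (m : Measure ℚ_[p]) [m.IsAddHaarMeasure] (x₀ : ℚ_[p]) (B : Set ℚ_[p])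
    (hB : MeasurableSet B) (c : ENNReal) :
    Measure.map (fun y => x₀ + y) (c • m.restrict B) =
      m.withDensity (((fun x => x - x₀) ⁻¹' B).indicator fun _ => c) := by
  have hB' : MeasurableSet ((fun x => x - x₀) ⁻¹' B) := hB.preimage (by fun_prop)
  rw [withDensity_indicator hB', withDensity_const, Measure.map_smul]
  congr 1
  have := ((measurePreserving_add_left m x₀).restrict_preimage hB').map_eq
  rw [← this]
  congr 2
  ext x; simp

theorem aux_forward (hp : 2 < p) (m : Measure ℚ_[p]) [m.IsAddHaarMeasure]
    (hm : m {x : ℚ_[p] | ‖x‖ ≤ 1} = 1)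
    {Ω : Type*} [MeasurableSpace Ω] (P : Measure Ω) [IsProbabilityMeasure P]
    (ξ η : Ω → ℚ_[p]) (hξ : Measurable ξ) (hη : Measurable η)
    (hindep : IndepFun ξ η P)
    (ρ : ℚ_[p] → ℝ) (hρc : Continuous ρ) (hρnn : ∀ x, 0 ≤ ρ x)
    (hξd : Measure.map ξ P = m.withDensity fun x => ENNReal.ofReal (ρ x))
    (hηd : Measure.map η P = m.withDensity fun x => ENNReal.ofReal (ρ x))
    (hI : IndepFun (fun ω => ξ ω + η ω) (fun ω => (ξ ω - η ω) ^ 2) P) :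
      ∃ (n : ℤ) (x₀ : ℚ_[p]),
        Measure.map ξ P = Measure.map (fun y => x₀ + y)
          ((m {x : ℚ_[p] | ‖x‖ ≤ (p : ℝ) ^ (-n)})⁻¹ •
            m.restrict {x : ℚ_[p] | ‖x‖ ≤ (p : ℝ) ^ (-n)}) := by
  have fe := aux_fe hp m hm P ξ η hξ hη hindep ρ hρc hρnn hξd hηd hI
  have hprob : IsProbabilityMeasure (Measure.map ξ P) :=
    Measure.isProbabilityMeasure_map hξ.aemeasurable
  obtain ⟨x₀, hx₀⟩ : ∃ x₀, ρ x₀ ≠ 0 := by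
    by_contra! h
    have h1 := hprob.measure_univ
    rw [hξd] at h1
    simp [h] at h1
  have hpos : 0 < ρ x₀ := lt_of_le_of_ne (hρnn _) hx₀.symm
  obtain ⟨E, hEo, hE1, hE0⟩ := aux_func (aux_norm_two hp) (fun x => ρ (x₀ + x) / ρ x₀)
    (by fun_prop) (fun x => div_nonneg (hρnn _) hpos.le) (by simp [hx₀]) (by
      intro a b
      have := fe (x₀ + a) b x₀ 0
      simp only [add_zero, sub_zero] at this
      simp only [← add_assoc, ← add_sub_assoc, ← sub_eq_add_neg]
      field_simp
      linear_combination this)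
  have hρ : (fun x => ENNReal.ofReal (ρ x)) =
      (((fun x => x - x₀) ⁻¹' (E : Set ℚ_[p])).indicator fun _ => ENNReal.ofReal (ρ x₀)) := by
    ext x
    by_cases hx : x - x₀ ∈ E
    · have := hE1 _ hx
      rw [add_sub_cancel, div_eq_one_iff_eq hx₀] at this
      rw [Set.indicator_of_mem (by exact hx), this]
    · have := hE0 _ hx
      rw [add_sub_cancel, div_eq_zero_iff, or_iff_left hx₀] at this
      rw [Set.indicator_of_notMem (by exact hx), this, ENNReal.ofReal_zero]
  rw [hρ, ← aux_shift m x₀ _ hEo.measurableSet] at hξd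
  have hmass : ENNReal.ofReal (ρ x₀) * m (E : Set ℚ_[p]) = 1 := by
    have h1 := hprob.measure_univ
    rw [hξd, Measure.map_apply (by fun_prop) MeasurableSet.univ] at h1
    simpa using h1
  have hne : (E : Set ℚ_[p]) ≠ Set.univ := by
    intro h
    rw [h, measure_univ_of_isAddLeftInvariant, ENNReal.mul_top (by simpa using hpos)] at hmass
    simp at hmass
  obtain ⟨n, hn⟩ := aux_subgroup E hEo hne
  refine ⟨n, x₀, ?_⟩
  rw [hξd, ← hn, ENNReal.eq_inv_of_mul_eq_one_left hmass]

theorem aux_backward (hp : 2 < p) (m : Measure ℚ_[p]) [m.IsAddHaarMeasure]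
    (hm : m {x : ℚ_[p] | ‖x‖ ≤ 1} = 1)
    {Ω : Type*} [MeasurableSpace Ω] (P : Measure Ω) [IsProbabilityMeasure P]
    (ξ η : Ω → ℚ_[p]) (hξ : Measurable ξ) (hη : Measurable η)
    (hindep : IndepFun ξ η P) (hid : Measure.map η P = Measure.map ξ P) (n : ℤ) (x₀ : ℚ_[p])
    (h : Measure.map ξ P = Measure.map (fun y => x₀ + y)
          ((m {x : ℚ_[p] | ‖x‖ ≤ (p : ℝ) ^ (-n)})⁻¹ •
            m.restrict {x : ℚ_[p] | ‖x‖ ≤ (p : ℝ) ^ (-n)})) :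
    IndepFun (fun ω => ξ ω + η ω) (fun ω => (ξ ω - η ω) ^ 2) P := by
  set B : Set ℚ_[p] := {x : ℚ_[p] | ‖x‖ ≤ (p : ℝ) ^ (-n)} with hBdef
  have hB : MeasurableSet B := (isClosed_le continuous_norm continuous_const).measurableSet
  set c := (m B)⁻¹
  rw [aux_shift m x₀ B hB] at h
  have hB1 : MeasurableSet ((fun x => x - x₀) ⁻¹' B) := hB.preimage (by fun_prop)
  have hB2 : MeasurableSet ((fun x => x - 2 * x₀) ⁻¹' B) := hB.preimage (by fun_prop)
  have hlaw := aux_law hp m hm P ξ η hξ hη hindep _ (measurable_const.indicator hB1) h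
    (hid.trans h)
  have hn2 := aux_norm_two hp
  have h2 : (2 : ℚ_[p]) ≠ 0 := by norm_num
  have hadd : ∀ {x y : ℚ_[p]}, x ∈ B → y ∈ B → x + y ∈ B := fun {x y} hx hy =>
    (Padic.nonarchimedean x y).trans (max_le hx hy)
  have hneg : ∀ {x : ℚ_[p]}, x ∈ B → -x ∈ B := fun {x} hx => by simpa [hBdef] using hx
  have hhalf : ∀ {x : ℚ_[p]}, x ∈ B → x / 2 ∈ B := fun {x} hx => by
    simpa [hBdef, hn2] using hx
  have hfac : (fun z : ℚ_[p] × ℚ_[p] =>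
      (((fun x => x - x₀) ⁻¹' B).indicator (fun _ => c)) ((z.1 + z.2) / 2) *
      (((fun x => x - x₀) ⁻¹' B).indicator (fun _ => c)) ((z.1 - z.2) / 2)) =
      fun z => (((fun x => x - 2 * x₀) ⁻¹' B).indicator (fun _ => c)) z.1 *
        (B.indicator (fun _ => c)) z.2 := by
    ext ⟨s, t⟩
    simp only
    have hiff : ((s + t) / 2 ∈ (fun x => x - x₀) ⁻¹' B ∧ (s - t) / 2 ∈ (fun x => x - x₀) ⁻¹' B) ↔
        (s ∈ (fun x => x - 2 * x₀) ⁻¹' B ∧ t ∈ B) := by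
      simp only [Set.mem_preimage]
      constructor
      · rintro ⟨u, v⟩
        refine ⟨?_, ?_⟩
        · convert hadd u v using 1; field_simp; ring
        · convert hadd u (hneg v) using 1; field_simp; ring
      · rintro ⟨u, v⟩
        refine ⟨?_, ?_⟩
        · convert hhalf (hadd u v) using 1; field_simp; ring
        · convert hhalf (hadd u (hneg v)) using 1; field_simp; ring
    by_cases h1 : (s + t) / 2 ∈ (fun x => x - x₀) ⁻¹' B ∧ (s - t) / 2 ∈ (fun x => x - x₀) ⁻¹' B
    · have h3 := hiff.1 h1
      rw [Set.indicator_of_mem h1.1, Set.indicator_of_mem h1.2, Set.indicator_of_mem h3.1,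
        Set.indicator_of_mem h3.2]
    · have h3 := fun q => h1 (hiff.2 q)
      have l : ∀ (X Y : Set ℚ_[p]) (u v : ℚ_[p]), ¬ (u ∈ X ∧ v ∈ Y) →
          X.indicator (fun _ => c) u * Y.indicator (fun _ => c) v = 0 := by
        intro X Y u v q
        by_cases hu : u ∈ X
        · have hv : v ∉ Y := fun hv => q ⟨hu, hv⟩
          simp [hv]
        · simp [hu]
      rw [l _ _ _ _ h1, l _ _ _ _ h3]
  rw [hfac, ← prod_withDensity (measurable_const.indicator hB2) (measurable_const.indicator hB)]
    at hlaw
  have hS : Measurable (fun ω => ξ ω + η ω) := by fun_prop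
  have hT : Measurable (fun ω => ξ ω - η ω) := by fun_prop
  set ν₁ := m.withDensity (((fun x => x - 2 * x₀) ⁻¹' B).indicator (fun _ => c))
  set ν₂ := m.withDensity (B.indicator (fun _ => c))
  have hmB0 : m B ≠ 0 := by
    have : Metric.closedBall (0 : ℚ_[p]) ((p : ℝ) ^ (-n)) = B := by ext; simp [hBdef]
    rw [← this]
    have hp0 : (0 : ℝ) < p := by positivity
    exact (Metric.measure_closedBall_pos m 0 (by positivity)).ne'
  have hmB1 : m B ≠ ⊤ := by
    have : Metric.closedBall (0 : ℚ_[p]) ((p : ℝ) ^ (-n)) = B := by ext; simp [hBdef]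
    rw [← this]
    exact measure_closedBall_lt_top.ne
  have hν₂ : IsProbabilityMeasure ν₂ := by
    constructor
    simp only [ν₂]
    rw [withDensity_indicator hB, withDensity_const]
    simpa [c] using ENNReal.inv_mul_cancel hmB0 hmB1
  have hν₁ : IsProbabilityMeasure ν₁ := by
    constructor
    simp only [ν₁]
    rw [← aux_shift m (2 * x₀) B hB, Measure.map_apply (by fun_prop) MeasurableSet.univ]
    simpa [c] using ENNReal.inv_mul_cancel hmB0 hmB1
  have hind : IndepFun (fun ω => ξ ω + η ω) (fun ω => ξ ω - η ω) P := by
    rw [indepFun_iff_map_prod_eq_prod_map_map hS.aemeasurable hT.aemeasurable, hlaw]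
    have e1 : Measure.map (fun ω => ξ ω + η ω) P = ν₁ := by
      have : Measure.map (fun ω => ξ ω + η ω) P =
        Measure.map Prod.fst (Measure.map (fun ω => (ξ ω + η ω, ξ ω - η ω)) P) := by
        rw [Measure.map_map measurable_fst (hS.prodMk hT)]; rfl
      rw [this, hlaw, Measure.map_fst_prod]; simp
    have e2 : Measure.map (fun ω => ξ ω - η ω) P = ν₂ := by
      have : Measure.map (fun ω => ξ ω - η ω) P =
        Measure.map Prod.snd (Measure.map (fun ω => (ξ ω + η ω, ξ ω - η ω)) P) := by
        rw [Measure.map_map measurable_snd (hS.prodMk hT)]; rfl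
      rw [this, hlaw, Measure.map_snd_prod]; simp
    rw [e1, e2]
  exact hind.comp measurable_id (by fun_prop : Measurable fun x : ℚ_[p] => x ^ 2)
end

end AuxAll

/-- Theorem 3: let `p > 2` be prime and `ξ, η` i.i.d. random variables with values in `ℚ_p`
whose common distribution `μ` has a continuous density `ρ` with respect to the Haar measure
`m` on `ℚ_p` (normalized so that `m(ℤ_p) = 1`). Then `S = ξ + η` and `D = (ξ - η)²` are
independent iff `μ` is an idempotent distribution, i.e. the translate by some `x₀ ∈ ℚ_p` of
the normalized Haar distribution of the compact subgroup `p^n ℤ_p` for some integer `n`. -/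
theorem indepFun_add_sq_sub_iff_idempotent_padic (p : ℕ) [Fact p.Prime] (hp : 2 < p)
    [MeasurableSpace ℚ_[p]] [BorelSpace ℚ_[p]]
    (m : Measure ℚ_[p]) [m.IsAddHaarMeasure] (hm : m {x : ℚ_[p] | ‖x‖ ≤ 1} = 1)
    {Ω : Type*} [MeasurableSpace Ω] (P : Measure Ω) [IsProbabilityMeasure P]
    (ξ η : Ω → ℚ_[p]) (hξ : Measurable ξ) (hη : Measurable η)
    (hindep : IndepFun ξ η P)
    (ρ : ℚ_[p] → ℝ) (hρc : Continuous ρ) (hρnn : ∀ x, 0 ≤ ρ x)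
    (hξd : Measure.map ξ P = m.withDensity fun x => ENNReal.ofReal (ρ x))
    (hηd : Measure.map η P = m.withDensity fun x => ENNReal.ofReal (ρ x)) :
    IndepFun (fun ω => ξ ω + η ω) (fun ω => (ξ ω - η ω) ^ 2) P ↔
      ∃ (n : ℤ) (x₀ : ℚ_[p]),
        Measure.map ξ P = Measure.map (fun y => x₀ + y)
          ((m {x : ℚ_[p] | ‖x‖ ≤ (p : ℝ) ^ (-n)})⁻¹ •
            m.restrict {x : ℚ_[p] | ‖x‖ ≤ (p : ℝ) ^ (-n)}) := by
  constructor
  · exact aux_forward hp m hm P ξ η hξ hη hindep ρ hρc hρnn hξd hηd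
  · rintro ⟨n, x₀, h⟩
    exact aux_backward hp m hm P ξ η hξ hη hindep (hηd.trans hξd.symm) n x₀ h
end

section
/- There do not exist independent identically distributed random variables ξ and η with values in the field ℚ₂ of 2-adic numbers whose common distribution has a continuous density with respect to the Haar measure on ℚ₂ and such that the random variables S = ξ + η and D = (ξ − η)² are independent. -/
open MeasureTheory ProbabilityTheory
open Filter Topology

lemma func_const (ρ : ℚ_[2] → ℝ) (hc : Continuous ρ) (h0 : ∀ x, 0 ≤ ρ x)
    (h : ∀ a u v, ρ (u+v) * ρ (u-v) * (ρ a * ρ a) = ρ u * ρ u * (ρ (a+v) * ρ (a-v)))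
    (a : ℚ_[2]) (ha : 0 < ρ a) (x : ℚ_[2]) : ρ x = ρ a := by
  have half : ∀ v, 0 < ρ (a + 2 * v) → 0 < ρ (a + v) := by
    intro v hv
    have h1 := h a (a+v) v
    rw [show a + v + v = a + 2 * v by ring, show a + v - v = a by ring] at h1
    rcases (h0 (a+v)).lt_or_eq with h2 | h2
    · exact h2
    · rw [← h2] at h1
      have : 0 < ρ (a + 2 * v) * ρ a * (ρ a * ρ a) := by positivity
      rw [h1] at this
      simp at this
  have hpow : ∀ (k : ℕ) v, 0 < ρ (a + 2 ^ k * v) → 0 < ρ (a + v) := by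
    intro k
    induction k with
    | zero => intro v; simp
    | succ k ih =>
      intro v hv
      apply half
      apply ih
      rwa [show a + 2 ^ k * (2 * v) = a + 2 ^ (k+1) * v by ring]
  have pos : ∀ y, 0 < ρ y := by
    intro y
    have ht : Tendsto (fun k : ℕ => ρ (a + 2 ^ k * (y - a))) atTop (𝓝 (ρ (a + 0 * (y-a)))) := by
      apply (hc.tendsto _).comp
      apply Tendsto.const_add
      apply Tendsto.mul_const
      apply tendsto_pow_atTop_nhds_zero_of_norm_lt_one
      have := Padic.norm_p (p := 2)
      push_cast at this
      rw [this]; norm_num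
    have := (ht.eventually (lt_mem_nhds (show 0 < ρ (a + 0 * (y-a)) by simpa using ha))).exists
    obtain ⟨k, hk⟩ := this
    have := hpow k _ hk
    simpa using this
  set r := max ‖x‖ ‖a‖
  have hK : IsCompact (Metric.closedBall (0 : ℚ_[2]) r) := isCompact_closedBall _ _
  have hx : x ∈ Metric.closedBall (0 : ℚ_[2]) r := by simp [r]
  have haK : a ∈ Metric.closedBall (0 : ℚ_[2]) r := by simp [r]
  have hadd : ∀ p ∈ Metric.closedBall (0 : ℚ_[2]) r, ∀ q ∈ Metric.closedBall (0 : ℚ_[2]) r,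
      p + q ∈ Metric.closedBall (0 : ℚ_[2]) r := by
    intro p hp q hq
    simp only [mem_closedBall_zero_iff] at *
    exact (Padic.nonarchimedean p q).trans (max_le hp hq)
  have hneg : ∀ p ∈ Metric.closedBall (0 : ℚ_[2]) r, -p ∈ Metric.closedBall (0 : ℚ_[2]) r := by
    intro p hp
    simpa using hp
  have hsub : ∀ p ∈ Metric.closedBall (0 : ℚ_[2]) r, ∀ q ∈ Metric.closedBall (0 : ℚ_[2]) r,
      p - q ∈ Metric.closedBall (0 : ℚ_[2]) r := by
    intro p hp q hq
    rw [sub_eq_add_neg]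
    exact hadd p hp _ (hneg q hq)
  obtain ⟨w, hw, hwm⟩ := hK.exists_isMaxOn ⟨a, haK⟩ hc.continuousOn
  obtain ⟨z, hz, hzm⟩ := hK.exists_isMinOn ⟨a, haK⟩ hc.continuousOn
  have key : ∀ y ∈ Metric.closedBall (0 : ℚ_[2]) r, ρ y = ρ w := by
    intro y hy
    have hv := hsub y hy w hw
    set v := y - w with hvd
    have e : w + v = y := by rw [hvd]; ring
    have h1 := h z w v
    rw [e] at h1
    have b1 : ρ y ≤ ρ w := hwm hy
    have b2 : ρ (w - v) ≤ ρ w := hwm (hsub w hw v hv)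
    have b3 : ρ z ≤ ρ (z + v) := hzm (hadd z hz v hv)
    have b4 : ρ z ≤ ρ (z - v) := hzm (hsub z hz v hv)
    have pz := pos z
    have pw := pos w
    have py := pos y
    have b5 : ρ z * ρ z ≤ ρ (z + v) * ρ (z - v) := mul_le_mul b3 b4 pz.le (h0 _)
    have b6 : ρ w * ρ w * (ρ z * ρ z) ≤ ρ y * ρ (w - v) * (ρ z * ρ z) := by
      rw [h1]; gcongr
    have b7 : ρ w * ρ w ≤ ρ y * ρ (w - v) := le_of_mul_le_mul_right b6 (by positivity)
    have b8 : ρ y * ρ (w - v) ≤ ρ y * ρ w := by gcongr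
    have b9 : ρ w ≤ ρ y := le_of_mul_le_mul_right (b7.trans b8) pw
    exact le_antisymm b1 b9
  rw [key x hx, key a haK]

noncomputable def psi : (ℚ_[2] × ℚ_[2]) ≃L[ℚ_[2]] (ℚ_[2] × ℚ_[2]) :=
  ContinuousLinearEquiv.equivOfInverse
    (((2:ℚ_[2])⁻¹ • (ContinuousLinearMap.fst ℚ_[2] ℚ_[2] ℚ_[2] + ContinuousLinearMap.snd ℚ_[2] ℚ_[2] ℚ_[2])).prod
     ((2:ℚ_[2])⁻¹ • (ContinuousLinearMap.fst ℚ_[2] ℚ_[2] ℚ_[2] - ContinuousLinearMap.snd ℚ_[2] ℚ_[2] ℚ_[2])))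
    ((ContinuousLinearMap.fst ℚ_[2] ℚ_[2] ℚ_[2] + ContinuousLinearMap.snd ℚ_[2] ℚ_[2] ℚ_[2]).prod
     (ContinuousLinearMap.fst ℚ_[2] ℚ_[2] ℚ_[2] - ContinuousLinearMap.snd ℚ_[2] ℚ_[2] ℚ_[2]))
    (by rintro ⟨x, y⟩; ext <;> simp <;> ring)
    (by rintro ⟨x, y⟩; ext <;> simp <;> ring)

lemma psi_apply (x y : ℚ_[2]) : psi (x, y) = (2⁻¹ * (x + y), 2⁻¹ * (x - y)) := by
  simp [psi, mul_add]

lemma map_psi [MeasurableSpace ℚ_[2]] [BorelSpace ℚ_[2]]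
    (m : Measure ℚ_[2]) [m.IsAddHaarMeasure] :
    ∃ c : NNReal, c ≠ 0 ∧ Measure.map psi (m.prod m) = c • (m.prod m) := by
  have : (Measure.map psi (m.prod m)).IsAddHaarMeasure := psi.isAddHaarMeasure_map _
  exact ⟨_, (Measure.addHaarScalarFactor_pos_of_isAddHaarMeasure _ _).ne',
    Measure.isAddLeftInvariant_eq_smul (Measure.map psi (m.prod m)) (m.prod m)⟩

lemma prob_eq [MeasurableSpace ℚ_[2]] [BorelSpace ℚ_[2]]
    (m : Measure ℚ_[2]) [m.IsAddHaarMeasure]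
    {Ω : Type*} [MeasurableSpace Ω] (P : Measure Ω) [IsProbabilityMeasure P]
    (ξ η : Ω → ℚ_[2]) (hξ : Measurable ξ) (hη : Measurable η)
    (hindep : IndepFun ξ η P)
    (ρ : ℚ_[2] → ℝ) (hρc : Continuous ρ) (hρnn : ∀ x, 0 ≤ ρ x)
    (hξd : Measure.map ξ P = m.withDensity fun x => ENNReal.ofReal (ρ x))
    (hηd : Measure.map η P = m.withDensity fun x => ENNReal.ofReal (ρ x))
    (c : NNReal) (hc : Measure.map psi (m.prod m) = c • (m.prod m))
    (E : Set (ℚ_[2] × ℚ_[2])) (hE : MeasurableSet E) :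
    P.real {ω | psi (ξ ω, η ω) ∈ E} =
      c * ∫ z in E, ρ (z.1 + z.2) * ρ (z.1 - z.2) ∂(m.prod m) := by
  have hpsi : Measurable psi := psi.continuous.measurable
  have hρ' : Measurable fun x => ENNReal.ofReal (ρ x) := hρc.measurable.ennreal_ofReal
  have hF : Continuous fun z : ℚ_[2] × ℚ_[2] => ρ (z.1 + z.2) * ρ (z.1 - z.2) := by fun_prop
  have h1 := (indepFun_iff_map_prod_eq_prod_map_map hξ.aemeasurable hη.aemeasurable).1 hindep
  rw [hξd, hηd, prod_withDensity hρ' hρ'] at h1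
  have h2 : P {ω | psi (ξ ω, η ω) ∈ E} = Measure.map (fun ω => (ξ ω, η ω)) P (psi ⁻¹' E) := by
    rw [Measure.map_apply (hξ.prodMk hη) (hpsi hE)]; rfl
  rw [h1, withDensity_apply _ (hpsi hE)] at h2
  have h3 : (c : ℝ) * ∫ z in E, ρ (z.1 + z.2) * ρ (z.1 - z.2) ∂(m.prod m)
      = ∫ z in E, ρ (z.1 + z.2) * ρ (z.1 - z.2) ∂(Measure.map psi (m.prod m)) := by
    rw [hc, Measure.restrict_smul, integral_smul_nnreal_measure]; rfl
  rw [h3, setIntegral_map hE hF.aestronglyMeasurable hpsi.aemeasurable,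
    integral_eq_lintegral_of_nonneg_ae (Eventually.of_forall fun z => mul_nonneg (hρnn _) (hρnn _))
      (by have := hF.comp psi.continuous; exact this.aestronglyMeasurable), measureReal_def, h2]
  congr 2
  ext ⟨x, y⟩
  rw [psi_apply, ← ENNReal.ofReal_mul (hρnn _)]
  simp only
  rw [show 2⁻¹ * (x + y) + 2⁻¹ * (x - y) = x by ring,
    show 2⁻¹ * (x + y) - 2⁻¹ * (x - y) = y by ring]

def Aset (u : ℚ_[2]) (r : ℝ) : Set ℚ_[2] := {x | ‖x - u‖ ≤ r}
def Cset (v : ℚ_[2]) (r : ℝ) : Set ℚ_[2] := {x | ‖x ^ 2 - v ^ 2‖ ≤ r ^ 2}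

lemma Aset_closed (u : ℚ_[2]) (r : ℝ) : IsClosed (Aset u r) :=
  isClosed_le (by fun_prop) (by fun_prop)
lemma Cset_closed (u : ℚ_[2]) (r : ℝ) : IsClosed (Cset u r) :=
  isClosed_le (by fun_prop) (by fun_prop)

lemma Cset_mem {v x : ℚ_[2]} {r : ℝ} (hr : 0 < r) (h : x ∈ Cset v r) :
    ‖x - v‖ ≤ r ∨ ‖x + v‖ ≤ r := by
  by_contra! hh
  have h' : ‖x ^ 2 - v ^ 2‖ ≤ r ^ 2 := h
  rw [show x ^ 2 - v ^ 2 = (x - v) * (x + v) by ring, norm_mul] at h'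
  nlinarith [mul_lt_mul'' hh.1 hh.2 hr.le hr.le]

lemma A_pos [MeasurableSpace ℚ_[2]] [BorelSpace ℚ_[2]]
    (m : Measure ℚ_[2]) [m.IsAddHaarMeasure] (u : ℚ_[2]) {r : ℝ} (hr : 0 < r) :
    0 < m.real (Aset u r) ∧ m (Aset u r) < ⊤ := by
  have hfin : m (Aset u r) < ⊤ := by
    refine lt_of_le_of_lt (measure_mono ?_) (isCompact_closedBall u r).measure_lt_top
    intro x hx
    have hx' : ‖x - u‖ ≤ r := hx
    simpa [dist_eq_norm] using hx'
  refine ⟨ENNReal.toReal_pos ?_ hfin.ne, hfin⟩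
  refine (Measure.measure_pos_of_mem_nhds m (x := u) ?_).ne'
  refine mem_of_superset (Metric.ball_mem_nhds u hr) ?_
  intro x hx
  rw [mem_ball_iff_norm] at hx
  exact hx.le

lemma C_pos [MeasurableSpace ℚ_[2]] [BorelSpace ℚ_[2]]
    (m : Measure ℚ_[2]) [m.IsAddHaarMeasure] (u : ℚ_[2]) {r : ℝ} (hr : 0 < r) :
    0 < m.real (Cset u r) ∧ m (Cset u r) < ⊤ := by
  have hfin : m (Cset u r) < ⊤ := by
    refine lt_of_le_of_lt (measure_mono (t := Metric.closedBall u r ∪ Metric.closedBall (-u) r) ?_)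
      ((isCompact_closedBall u r).union (isCompact_closedBall (-u) r)).measure_lt_top
    intro x hx
    simpa [dist_eq_norm] using Cset_mem hr hx
  refine ⟨ENNReal.toReal_pos ?_ hfin.ne, hfin⟩
  refine (Measure.measure_pos_of_mem_nhds m (x := u) ?_).ne'
  have hc : Continuous fun x : ℚ_[2] => ‖x ^ 2 - u ^ 2‖ := by fun_prop
  have := (hc.tendsto u).eventually (gt_mem_nhds (show ‖u ^ 2 - u ^ 2‖ < r ^ 2 by simp; positivity))
  filter_upwards [this] with x hx
  exact hx.le

lemma lim_F [MeasurableSpace ℚ_[2]] [BorelSpace ℚ_[2]]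
    (m : Measure ℚ_[2]) [m.IsAddHaarMeasure] (F : ℚ_[2] × ℚ_[2] → ℝ) (hF : Continuous F)
    (hs : ∀ u v, F (u, -v) = F (u, v)) (u v : ℚ_[2]) :
    Tendsto (fun r => (∫ z in Aset u r ×ˢ Cset v r, F z ∂(m.prod m)) /
      (m.real (Aset u r) * m.real (Cset v r))) (𝓝[>] (0:ℝ)) (𝓝 (F (u, v))) := by
  rw [Metric.tendsto_nhds]
  intro ε hε
  obtain ⟨δ, hδ, h⟩ := Metric.continuous_iff.1 hF (u, v) (ε/2) (by positivity)
  filter_upwards [Ioo_mem_nhdsGT hδ] with r hr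
  obtain ⟨hr0, hr1⟩ := hr
  obtain ⟨a1, a2⟩ := A_pos m u hr0
  obtain ⟨c1, c2⟩ := C_pos m v hr0
  have hbound : ∀ z ∈ Aset u r ×ˢ Cset v r, ‖F z - F (u, v)‖ ≤ ε / 2 := by
    rintro ⟨x, y⟩ ⟨hx, hy⟩
    simp only at hx hy
    have hx' : ‖x - u‖ < δ := lt_of_le_of_lt hx hr1
    rcases Cset_mem hr0 hy with h1 | h1
    · have := h (x, y) (by
        rw [dist_eq_norm, Prod.norm_def]; exact max_lt hx' (lt_of_le_of_lt h1 hr1))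
      exact this.le
    · have := h (x, -y) (by
        rw [dist_eq_norm, Prod.norm_def]
        refine max_lt hx' (lt_of_le_of_lt (le_of_eq ?_) (lt_of_le_of_lt h1 hr1))
        rw [← norm_neg]; congr 1; simp; ring)
      rw [hs] at this
      exact this.le
  have hM : (m.prod m) (Aset u r ×ˢ Cset v r) < ⊤ := by
    rw [Measure.prod_prod]; exact ENNReal.mul_lt_top a2 c2
  have hMr : (m.prod m).real (Aset u r ×ˢ Cset v r) = m.real (Aset u r) * m.real (Cset v r) := by
    rw [measureReal_prod_prod]
  have hb := norm_setIntegral_le_of_norm_le_const hM hbound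
  have hconst : IntegrableOn (fun _ => F (u, v)) (Aset u r ×ˢ Cset v r) (m.prod m) :=
    integrableOn_const hM.ne
  have hint : IntegrableOn F (Aset u r ×ˢ Cset v r) (m.prod m) := by
    have : IntegrableOn (fun z => F z - F (u, v)) (Aset u r ×ˢ Cset v r) (m.prod m) := by
      refine Measure.integrableOn_of_bounded (M := ε/2) hM.ne ?_ ?_
      · exact (hF.sub continuous_const).aestronglyMeasurable
      · exact (ae_restrict_iff' ((Aset_closed u r).measurableSet.prod
          (Cset_closed v r).measurableSet)).2 (Eventually.of_forall hbound)
    have h2 := this.add hconst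
    refine h2.congr (Eventually.of_forall fun z => ?_)
    simp
  rw [integral_sub hint hconst, setIntegral_const, hMr] at hb
  have hMp : 0 < m.real (Aset u r) * m.real (Cset v r) := by positivity
  rw [dist_eq_norm]
  set M := m.real (Aset u r) * m.real (Cset v r)
  set I := ∫ z in Aset u r ×ˢ Cset v r, F z ∂(m.prod m)
  rw [show I / M - F (u, v) = (I - M • F (u, v)) / M by simp; field_simp, norm_div,
    Real.norm_of_nonneg hMp.le, div_lt_iff₀ hMp]
  nlinarith

/-- Remark 3: there do not exist i.i.d. random variables `ξ, η` with values in the field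
`ℚ₂` of `2`-adic numbers, whose common distribution has a continuous density `ρ` with respect
to the Haar measure `m` on `ℚ₂` (normalized so that `m(ℤ₂) = 1`), such that `S = ξ + η` and
`D = (ξ - η)²` are independent. -/
theorem no_indep_sum_sq_diff_two_adic
    [MeasurableSpace ℚ_[2]] [BorelSpace ℚ_[2]]
    (m : Measure ℚ_[2]) [m.IsAddHaarMeasure] (hm : m {x : ℚ_[2] | ‖x‖ ≤ 1} = 1)
    {Ω : Type*} [MeasurableSpace Ω] (P : Measure Ω) [IsProbabilityMeasure P]
    (ξ η : Ω → ℚ_[2]) (hξ : Measurable ξ) (hη : Measurable η)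
    (hindep : IndepFun ξ η P)
    (ρ : ℚ_[2] → ℝ) (hρc : Continuous ρ) (hρnn : ∀ x, 0 ≤ ρ x)
    (hξd : Measure.map ξ P = m.withDensity fun x => ENNReal.ofReal (ρ x))
    (hηd : Measure.map η P = m.withDensity fun x => ENNReal.ofReal (ρ x)) :
    ¬ IndepFun (fun ω => ξ ω + η ω) (fun ω => (ξ ω - η ω) ^ 2) P := by
  intro hSD
  obtain ⟨c, hc0, hc⟩ := map_psi m
  set F : ℚ_[2] × ℚ_[2] → ℝ := fun z => ρ (z.1 + z.2) * ρ (z.1 - z.2) with hFdef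
  have hF : Continuous F := by fun_prop
  have hs : ∀ u v, F (u, -v) = F (u, v) := by
    intro u v
    simp only [hFdef, sub_neg_eq_add, ← sub_eq_add_neg]
    ring
  have hfac : ∀ u v r, (c : ℝ) * ∫ z in Aset u r ×ˢ Cset v r, F z ∂(m.prod m) =
      P.real ((fun ω => ξ ω + η ω) ⁻¹' {s | 2⁻¹ * s ∈ Aset u r}) *
      P.real ((fun ω => (ξ ω - η ω) ^ 2) ⁻¹' {d | ‖4⁻¹ * d - v ^ 2‖ ≤ r ^ 2}) := by
    intro u v r
    rw [← prob_eq m P ξ η hξ hη hindep ρ hρc hρnn hξd hηd c hc _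
      ((Aset_closed u r).measurableSet.prod (Cset_closed v r).measurableSet)]
    have := hSD.measure_inter_preimage_eq_mul {s | 2⁻¹ * s ∈ Aset u r}
      {d | ‖4⁻¹ * d - v ^ 2‖ ≤ r ^ 2}
      (((Aset_closed u r).preimage (continuous_const_mul _)).measurableSet)
      (isClosed_le (by fun_prop) (by fun_prop)).measurableSet
    simp only [measureReal_def]
    rw [← ENNReal.toReal_mul, ← this]
    congr 2
    ext ω
    simp only [psi_apply, Set.mem_ofPred_eq, Set.mem_prod, Set.mem_inter_iff, Set.mem_preimage, Cset]
    rw [show (2⁻¹ * (ξ ω - η ω)) ^ 2 = 4⁻¹ * (ξ ω - η ω) ^ 2 by ring]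
  have hcross : ∀ u v u' v', F (u, v) * F (u', v') = F (u, v') * F (u', v) := by
    intro u v u' v'
    have l1 := (lim_F m F hF hs u v).mul (lim_F m F hF hs u' v')
    have l2 := (lim_F m F hF hs u v').mul (lim_F m F hF hs u' v)
    refine tendsto_nhds_unique l1 (l2.congr fun r => ?_)
    have hc' : (c : ℝ) ≠ 0 := by exact_mod_cast hc0
    have key : (∫ z in Aset u r ×ˢ Cset v' r, F z ∂(m.prod m)) *
        (∫ z in Aset u' r ×ˢ Cset v r, F z ∂(m.prod m)) =
        (∫ z in Aset u r ×ˢ Cset v r, F z ∂(m.prod m)) *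
        (∫ z in Aset u' r ×ˢ Cset v' r, F z ∂(m.prod m)) := by
      apply mul_left_cancel₀ (mul_ne_zero hc' hc')
      rw [mul_mul_mul_comm (c : ℝ) c, mul_mul_mul_comm (c : ℝ) c (∫ z in Aset u r ×ˢ Cset v r, F z ∂(m.prod m)),
        hfac, hfac, hfac, hfac]
      ring
    rw [div_mul_div_comm, div_mul_div_comm, key]
    congr 1
    ring
  have hfun : ∀ a u v, ρ (u+v) * ρ (u-v) * (ρ a * ρ a) = ρ u * ρ u * (ρ (a+v) * ρ (a-v)) := by
    intro a u v
    have := hcross u v a 0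
    simpa [hFdef] using this
  have htot : (m.withDensity fun x => ENNReal.ofReal (ρ x)) Set.univ = 1 := by
    rw [← hξd, Measure.map_apply hξ MeasurableSet.univ]; simp
  rw [withDensity_apply _ MeasurableSet.univ, Measure.restrict_univ] at htot
  have hpos : ∃ a, 0 < ρ a := by
    by_contra! hh
    have : ∀ x, ENNReal.ofReal (ρ x) = 0 := fun x => ENNReal.ofReal_eq_zero.2 (hh x)
    simp [this] at htot
  obtain ⟨a, ha⟩ := hpos
  simp only [func_const ρ hρc hρnn hfun a ha, lintegral_const,
    measure_univ_of_isAddLeftInvariant] at htot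
  rw [ENNReal.mul_top (by simpa using ha)] at htot
  simp at htot
end

section
/- Let G be an abelian group and φ : G → ℝ a function satisfying 2φ(0) + φ(u+v) + φ(u−v) = 2φ(u) + φ(v) + φ(−v) for all u, v ∈ G. Then for all u, v, h, k ∈ G the iterated finite difference Δ_{2h} Δ_u Δ_k φ(v) = 0, where Δ_h φ(x) = φ(x + h) − φ(x). In particular, if G has unique division by 2, then Δ_u³ φ(v) = 0 for all u, v ∈ G. -/
/-- The finite difference operator: `(Δ_h φ)(x) = φ(x + h) - φ(x)`. -/
def finDiff {G : Type*} [AddCommGroup G] (h : G) (φ : G → ℝ) (x : G) : ℝ :=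
  φ (x + h) - φ x

theorem odd_add {G : Type*} [AddCommGroup G] (o : G → ℝ)
    (ho : ∀ x, o (-x) = -o x) (h : ∀ u v : G, o (u + v) + o (u - v) = 2 * o u) (u v : G) :
    o (u + v) = o u + o v := by
  have h1 := h u v
  have h2 := h v u
  have h3 := ho (u - v)
  rw [neg_sub] at h3
  rw [add_comm v u] at h2
  linarith

theorem quad_add {G : Type*} [AddCommGroup G] (q : G → ℝ) (hq : ∀ x, q (-x) = q x)
    (h : ∀ u v : G, q (u + v) + q (u - v) = 2 * q u + 2 * q v) (x y z : G) :
    q (x + y + z) + q x + q y + q z = q (x + y) + q (y + z) + q (x + z) := by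
  have h1 := h (x + z) y
  have h2 := h x (z - y)
  have h3 := h (x + y) z
  have h4 := h y z
  have h5 := hq (y - z)
  rw [neg_sub] at h5
  rw [show x + z + y = x + y + z by abel] at h1
  rw [show x + (z - y) = x + z - y by abel, show x - (z - y) = x + y - z by abel] at h2
  linarith

theorem second_diff {G : Type*} [AddCommGroup G] (φ : G → ℝ)
    (heq : ∀ u v : G, 2 * φ 0 + φ (u + v) + φ (u - v) = 2 * φ u + φ v + φ (-v)) (x y z : G) :
    φ (x + y + z) + φ x + φ y + φ z = φ (x + y) + φ (y + z) + φ (x + z) + φ 0 := by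
  have key : ∀ u v : G, 2 * φ 0 + φ (-(u + v)) + φ (-(u - v)) = 2 * φ (-u) + φ v + φ (-v) := by
    intro u v
    have := heq (-u) v
    rw [show -u + v = -(u - v) by abel, show -u - v = -(u + v) by abel] at this
    linarith
  have hq := quad_add (fun x => φ x + φ (-x) - 2 * φ 0) (fun x => by simp only [neg_neg]; ring)
    (fun u v => by have := heq u v; have := key u v; linarith) x y z
  have ho := odd_add (fun x => φ x - φ (-x)) (fun x => by simp only [neg_neg]; ring)
    (fun u v => by have := heq u v; have := key u v; linarith)
  have h1 := ho (x + y) z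
  have h2 := ho x y
  have h3 := ho y z
  have h4 := ho x z
  linarith

theorem third_diff {G : Type*} [AddCommGroup G] (φ : G → ℝ)
    (heq : ∀ u v : G, 2 * φ 0 + φ (u + v) + φ (u - v) = 2 * φ u + φ v + φ (-v)) (a u k v : G) :
    finDiff a (finDiff u (finDiff k φ)) v = 0 := by
  have h1 := second_diff φ heq (v + a) u k
  have h2 := second_diff φ heq v u k
  simp only [finDiff]
  linarith

/-- If `φ : G → ℝ` on an abelian group `G` satisfies
`2φ(0) + φ(u+v) + φ(u-v) = 2φ(u) + φ(v) + φ(-v)` for all `u, v`, then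
`Δ_{2h} Δ_u Δ_k φ(v) = 0` for all `u, v, h, k ∈ G`; in particular, if `G` has unique
division by 2, then `Δ_u³ φ(v) = 0` for all `u, v ∈ G`. -/
theorem third_differences_vanish {G : Type*} [AddCommGroup G] (φ : G → ℝ)
    (heq : ∀ u v : G, 2 * φ 0 + φ (u + v) + φ (u - v) = 2 * φ u + φ v + φ (-v)) :
    (∀ u v h k : G, finDiff (h + h) (finDiff u (finDiff k φ)) v = 0) ∧
      (Function.Bijective (fun x : G => x + x) →
        ∀ u v : G, finDiff u (finDiff u (finDiff u φ)) v = 0) := by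
  exact ⟨fun u v h k => third_diff φ heq (h + h) u k v,
    fun _ u v => third_diff φ heq u u u v⟩
end

section
/- Let G = ℤ[1/2] be the additive group of dyadic rational numbers, and let φ : G → ℝ satisfy Δ_u³ φ(v) = 0 for all u, v ∈ G (all third finite differences vanish). Then there exist real constants a, b, c such that φ(r) = a·r² + b·r + c for all r ∈ G. -/
/-- The set of dyadic rational numbers `{m / 2ⁿ : m ∈ ℤ, n ∈ ℕ}` inside `ℚ`. -/
def dyadicRationals : Set ℚ :=
  {x : ℚ | ∃ (m : ℤ) (n : ℕ), x = (m : ℚ) / 2 ^ n}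

theorem int_aux (g : ℤ → ℝ) (hg : ∀ m, g (m + 3) - 3 * g (m + 2) + 3 * g (m + 1) - g m = 0)
    (h0 : g 0 = 0) (h1 : g 1 = 0) (h2 : g 2 = 0) (m : ℤ) : g m = 0 := by
  have key : ∀ m : ℤ, g m = 0 ∧ g (m + 1) = 0 ∧ g (m + 2) = 0 := by
    intro m
    induction m using Int.induction_on with
    | zero => simpa using ⟨h0, h1, h2⟩
    | succ k ih =>
      obtain ⟨a, b, c⟩ := ih
      have := hg k
      rw [show (k : ℤ) + 1 + 1 = k + 2 by ring, show (k : ℤ) + 1 + 2 = k + 3 by ring]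
      exact ⟨b, c, by linarith⟩
    | pred k ih =>
      obtain ⟨a, b, c⟩ := ih
      have := hg (-(k : ℤ) - 1)
      rw [show -(k : ℤ) - 1 + 3 = -k + 2 by ring, show -(k : ℤ) - 1 + 2 = -k + 1 by ring,
        show -(k : ℤ) - 1 + 1 = -k by ring] at this
      rw [show -(k : ℤ) - 1 + 2 = -k + 1 by ring, show -(k : ℤ) - 1 + 1 = -k by ring]
      exact ⟨by linarith, a, b⟩
  exact (key m).1

theorem dyadic_aux (F : ℚ → ℝ)
    (h : ∀ u ∈ dyadicRationals, ∀ v ∈ dyadicRationals,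
      F (v + 3 * u) - 3 * F (v + 2 * u) + 3 * F (v + u) - F v = 0)
    (h0 : F 0 = 0) (h1 : F 1 = 0) (h2 : F 2 = 0) (n : ℕ) :
    ∀ m : ℤ, F ((m : ℚ) / 2 ^ n) = 0 := by
  have hrec : ∀ (n : ℕ) (m : ℤ), F (((m + 3 : ℤ) : ℚ) / 2 ^ n) - 3 * F (((m + 2 : ℤ) : ℚ) / 2 ^ n)
      + 3 * F (((m + 1 : ℤ) : ℚ) / 2 ^ n) - F ((m : ℚ) / 2 ^ n) = 0 := by
    intro n m
    have := h (1 / 2 ^ n) ⟨1, n, by simp⟩ ((m : ℚ) / 2 ^ n) ⟨m, n, rfl⟩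
    rw [← this]
    push_cast
    congr 4 <;> [skip; congr 2; congr 2] <;> ring_nf
  induction n with
  | zero =>
    exact int_aux (fun m => F ((m : ℚ) / 2 ^ 0)) (hrec 0) (by simpa using h0) (by simpa using h1)
      (by simpa using h2)
  | succ n ih =>
    have e0 : F (((0 : ℤ) : ℚ) / 2 ^ (n + 1)) = 0 := by simpa using h0
    have e2 : F (((2 : ℤ) : ℚ) / 2 ^ (n + 1)) = 0 := by
      rw [← ih 1]; congr 1; push_cast; field_simp; try ring
    have e4 : F (((4 : ℤ) : ℚ) / 2 ^ (n + 1)) = 0 := by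
      rw [← ih 2]; congr 1; push_cast; field_simp; try ring
    have r0 := hrec (n + 1) 0
    have r1 := hrec (n + 1) 1
    rw [show (0 : ℤ) + 3 = 3 by rfl, show (0 : ℤ) + 2 = 2 by rfl, show (0 : ℤ) + 1 = 1 by rfl] at r0
    rw [show (1 : ℤ) + 3 = 4 by rfl, show (1 : ℤ) + 2 = 3 by rfl, show (1 : ℤ) + 1 = 2 by rfl] at r1
    refine int_aux (fun m => F ((m : ℚ) / 2 ^ (n + 1))) (hrec (n + 1)) e0 ?_ e2
    show F (((1 : ℤ) : ℚ) / 2 ^ (n + 1)) = 0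
    linarith

/-- If `φ` is a real-valued function on the additive group `ℤ[1/2]` of dyadic rationals all
of whose third finite differences vanish, i.e.
`Δ_u³ φ(v) = φ(v + 3u) - 3φ(v + 2u) + 3φ(v + u) - φ(v) = 0` for all dyadic `u, v`, then
there are real constants `a, b, c` with `φ(r) = a·r² + b·r + c` for all dyadic `r`. -/
theorem dyadic_third_differences_vanish_iff_quadratic (φ : ℚ → ℝ)
    (h : ∀ u ∈ dyadicRationals, ∀ v ∈ dyadicRationals,
      φ (v + 3 * u) - 3 * φ (v + 2 * u) + 3 * φ (v + u) - φ v = 0) :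
    ∃ a b c : ℝ, ∀ r ∈ dyadicRationals, φ r = a * (r : ℝ) ^ 2 + b * (r : ℝ) + c := by
  obtain ⟨a, ha⟩ : ∃ a, a = (φ 2 - 2 * φ 1 + φ 0) / 2 := ⟨_, rfl⟩
  obtain ⟨b, hb⟩ : ∃ b, b = φ 1 - φ 0 - a := ⟨_, rfl⟩
  refine ⟨a, b, φ 0, ?_⟩
  rintro r ⟨m, n, rfl⟩
  have := dyadic_aux (fun r => φ r - (a * (r : ℝ) ^ 2 + b * (r : ℝ) + φ 0)) ?_ ?_ ?_ ?_ n m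
  · exact sub_eq_zero.mp this
  · intro u hu v hv
    have := h u hu v hv
    push_cast
    linear_combination this
  · simp
  · push_cast; rw [hb]; ring
  · push_cast; rw [hb, ha]; ring
end
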